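/- Let A be a unital C*-algebra and a ∈ A a positive element. Then a is invertible in A if and only if for every real α > 0 there exist constants c, C > 0 such that c · ‖f‖ ≤ r_{a^α}(f) ≤ C · ‖f‖ for every hermitian continuous linear functional f on A. -/

import Mathlib

open scoped ComplexOrder NNReal

variable {A : Type*} [CStarAlgebra A] [PartialOrder A] [StarOrderedRing A]

/-- A continuous linear functional on a C*-algebra is positive if it is nonnegative on
positive elements (using the complex order). -/
def IsPosFunctional {A : Type*} [CStarAlgebra A] [PartialOrder A] [StarOrderedRing A]
    (f : A →L[ℂ] ℂ) : Prop :=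
  ∀ x : A, 0 ≤ x → 0 ≤ f x

/-- A continuous linear functional is hermitian if `f (star x) = conj (f x)` for all `x`. -/
def IsHermitianFunctional {A : Type*} [CStarAlgebra A] (f : A →L[ℂ] ℂ) : Prop :=
  ∀ x : A, f (star x) = starRingEnd ℂ (f x)

/-- The seminorm `r_a` associated with a positive element `a`:
`r_a(f) = inf { f₁(a) + f₂(a) | f = f₁ - f₂, f₁, f₂ positive }`. -/
noncomputable def rSeminorm {A : Type*} [CStarAlgebra A] [PartialOrder A] [StarOrderedRing A]
    (a : A) (f : A →L[ℂ] ℂ) : ℝ :=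
  sInf { r : ℝ | ∃ f₁ f₂ : A →L[ℂ] ℂ, IsPosFunctional f₁ ∧ IsPosFunctional f₂ ∧
    f = f₁ - f₂ ∧ (r : ℂ) = f₁ a + f₂ a }


open ComplexStarModule in
lemma aux_extend (g : selfAdjoint A →ₗ[ℝ] ℝ) (hg : ∀ x : selfAdjoint A, 0 ≤ (x : A) → 0 ≤ g x) :
    ∃ φ : A →L[ℂ] ℂ, IsPosFunctional φ ∧
      ∀ x : A, φ x = (g (ℜ x) : ℂ) + (g (ℑ x) : ℂ) * Complex.I := by
  let L : A →ₗ[ℂ] ℂ :=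
    { toFun := fun x => (g (ℜ x) : ℂ) + (g (ℑ x) : ℂ) * Complex.I
      map_add' := by intro x y; simp; ring
      map_smul' := by
        intro z x
        apply Complex.ext <;> simp [realPart_smul, imaginaryPart_smul] <;> ring }
  have hL : ∀ x, 0 ≤ x → 0 ≤ L x := by
    intro x hx
    have hsa : IsSelfAdjoint x := .of_nonneg hx
    have h1 : ℑ x = 0 := hsa.imaginaryPart
    have h2 : 0 ≤ g (ℜ x) := hg _ (by rw [hsa.coe_realPart]; exact hx)
    simp only [L, LinearMap.coe_mk, AddHom.coe_mk, h1, map_zero, Complex.ofReal_zero, zero_mul,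
      add_zero]
    exact_mod_cast h2
  let P : A →ₚ[ℂ] ℂ := PositiveLinearMap.mk₀ L hL
  exact ⟨⟨L, map_continuous P⟩, hL, fun x => rfl⟩

lemma aux_norm_le (f : A →L[ℂ] ℂ) (hf : IsPosFunctional f) : ‖f‖ ≤ 4 * (f 1).re := by
  have h1 := Complex.nonneg_iff.1 (hf 1 zero_le_one)
  have hn : ‖f 1‖ = (f 1).re := by
    rw [← abs_of_nonneg h1.1]
    exact (Complex.abs_re_eq_norm.2 h1.2.symm).symm
  refine f.opNorm_le_bound (by linarith [h1.1]) fun x => ?_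
  let P : A →ₚ[ℂ] ℂ := PositiveLinearMap.mk₀ (f : A →ₗ[ℂ] ℂ) hf
  have hP : ∀ x, 0 ≤ x → ‖f x‖ ≤ (f 1).re * ‖x‖ := fun x hx => by
    rw [← hn]; exact P.norm_apply_le_of_nonneg x hx
  obtain ⟨y, hy0, hyn, hy⟩ := CStarAlgebra.exists_sum_four_nonneg x
  conv_lhs => rw [hy]
  simp only [map_sum, map_smul]
  apply (norm_sum_le _ _).trans
  simp only [norm_smul, norm_pow, Complex.norm_I, one_pow, one_mul]
  apply (Finset.sum_le_sum (g := fun _ ↦ (f 1).re * ‖x‖) (fun i _ ↦ ?_)).trans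
  · simp [mul_assoc]
  · exact (hP _ (hy0 i)).trans (mul_le_mul_of_nonneg_left (hyn i) h1.1)

lemma aux_mono (f : A →L[ℂ] ℂ) (hf : IsPosFunctional f) {x y : A} (h : x ≤ y) :
    (f x).re ≤ (f y).re := by
  have := (Complex.nonneg_iff.1 (hf (y - x) (sub_nonneg.2 h))).1
  simp at this; linarith

lemma aux_hermitian (f : A →L[ℂ] ℂ) (hf : IsPosFunctional f) : IsHermitianFunctional f := by
  let P : A →ₚ[ℂ] ℂ := PositiveLinearMap.mk₀ (f : A →ₗ[ℂ] ℂ) hf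
  intro x
  exact map_star P x

lemma aux_algebraMap (f : A →L[ℂ] ℂ) (t : ℝ) : (f (algebraMap ℝ A t)).re = t * (f 1).re := by
  rw [Algebra.algebraMap_eq_smul_one, ← Complex.coe_smul, map_smul]
  simp

/-- norm bound for order intervals -/
lemma aux_interval (x : A) (t : ℝ) (h1 : 0 ≤ x + algebraMap ℝ A t)
    (h2 : 0 ≤ -x + algebraMap ℝ A t) : ‖x‖ ≤ 3 * t ∨ ‖x‖ = 0 := by
  rcases subsingleton_or_nontrivial A with h | h
  · right; rw [Subsingleton.elim x 0, norm_zero]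
  left
  have h3 : (0 : A) ≤ algebraMap ℝ A (2 * t) := by
    have := add_nonneg h1 h2
    rw [two_mul, map_add]
    convert this using 1; abel
  have ht : 0 ≤ t := by
    by_contra hneg
    push Not at hneg
    have h4 : (0 : A) ≤ algebraMap ℝ A (-(2 * t)) := algebraMap_nonneg _ (by linarith)
    rw [map_neg] at h4
    have h5 : algebraMap ℝ A (2 * t) = 0 := le_antisymm (neg_nonneg.1 h4) h3
    have := (map_eq_zero_iff _ (algebraMap ℝ A).injective).1 h5
    linarith
  have h4 : x + algebraMap ℝ A t ≤ algebraMap ℝ A (2 * t) := by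
    rw [← sub_nonneg, two_mul, map_add]
    convert h2 using 1; abel
  have h5 := (CStarAlgebra.norm_le_iff_le_algebraMap _ (by linarith : (0:ℝ) ≤ 2 * t) h1).2 h4
  calc ‖x‖ = ‖(x + algebraMap ℝ A t) - algebraMap ℝ A t‖ := by simp
    _ ≤ ‖x + algebraMap ℝ A t‖ + ‖algebraMap ℝ A t‖ := norm_sub_le _ _
    _ ≤ 2 * t + t := by
      gcongr
      rw [norm_algebraMap', Real.norm_of_nonneg ht]
    _ = 3 * t := by ring

open ComplexStarModule in
lemma aux_jordan (f : A →L[ℂ] ℂ) (hf : IsHermitianFunctional f) :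
    ∃ f₁ f₂ : A →L[ℂ] ℂ, IsPosFunctional f₁ ∧ IsPosFunctional f₂ ∧ f = f₁ - f₂ ∧
      (f₁ 1).re + (f₂ 1).re ≤ 3 * ‖f‖ := by
  rcases subsingleton_or_nontrivial A with hA | hA
  · refine ⟨0, 0, fun _ _ => by simp, fun _ _ => by simp, ?_, by simp⟩
    ext x; rw [Subsingleton.elim x 0]; simp
  let V := selfAdjoint A
  let e : V := 1
  let j : (V × ℝ) →ₗ[ℝ] (V × V) :=
    { toFun := fun p => (p.1 + p.2 • e, -p.1 + p.2 • e)
      map_add' := by intro p q; ext <;> simp [add_smul] <;> abel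
      map_smul' := by intro c p; ext <;> simp [mul_smul] }
  have hj : Function.Injective j := by
    rw [injective_iff_map_eq_zero]
    rintro ⟨x, t⟩ h
    have h1 : x + t • e = 0 := congrArg Prod.fst h
    have h2 : -x + t • e = 0 := congrArg Prod.snd h
    have h3 : (2 * t) • e = 0 := by
      have := congrArg₂ (· + ·) h1 h2
      simp only [add_zero] at this
      rw [two_mul, add_smul, ← this]; abel
    have he : e ≠ 0 := fun h => one_ne_zero (α := A) (congrArg Subtype.val h)
    have h4 : t = 0 := by
      rcases smul_eq_zero.1 h3 with h | h
      · linarith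
      · exact absurd h he
    subst h4
    simpa using h1
  let F : (V × ℝ) →ₗ[ℝ] ℝ :=
    { toFun := fun p => (f (p.1 : A)).re + p.2 * (3 * ‖f‖)
      map_add' := by intro p q; simp; ring
      map_smul' := by
        intro c p
        have hc : (((c • p).1 : V) : A) = c • (p.1 : A) := rfl
        rw [hc, ← Complex.coe_smul, map_smul]
        simp; ring }
  let s : PointedCone ℝ (V × V) :=
    { carrier := {p | (0 : A) ≤ p.1 ∧ (0 : A) ≤ p.2}
      zero_mem' := by simp
      add_mem' := by
        intro p q hp hq
        exact ⟨by simpa using add_nonneg hp.1 hq.1, by simpa using add_nonneg hp.2 hq.2⟩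
      smul_mem' := by
        intro c p hp
        exact ⟨smul_nonneg c.2 hp.1, smul_nonneg c.2 hp.2⟩ }
  let E := LinearEquiv.ofInjective j hj
  let p : (V × V) →ₗ.[ℝ] ℝ := ⟨LinearMap.range j, F ∘ₗ E.symm.toLinearMap⟩
  have hp : ∀ q : V × ℝ, p ⟨j q, LinearMap.mem_range_self j q⟩ = F q := by
    intro q
    change F (E.symm (E q)) = F q
    rw [E.symm_apply_apply]
  have hal : ∀ t : ℝ, ((t • e : V) : A) = algebraMap ℝ A t := by
    intro t; rw [Algebra.algebraMap_eq_smul_one]; rfl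
  obtain ⟨Φ, hΦ, hΦs⟩ := riesz_extension s p (by
      rintro ⟨_, ⟨⟨x, t⟩, rfl⟩⟩ hx
      rw [hp]
      have h1 : (0 : A) ≤ x + algebraMap ℝ A t := by rw [← hal]; exact hx.1
      have h2 : (0 : A) ≤ -x + algebraMap ℝ A t := by rw [← hal]; exact hx.2
      change 0 ≤ (f (x : A)).re + t * (3 * ‖f‖)
      have h3 : -(‖f‖ * ‖(x : A)‖) ≤ (f (x : A)).re :=
        (abs_le.1 ((Complex.abs_re_le_norm _).trans (f.le_opNorm _))).1
      have ht : 0 ≤ t := by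
        by_contra hneg
        push Not at hneg
        rcases aux_interval (x : A) t h1 h2 with h | h
        · linarith [norm_nonneg (x : A)]
        · rw [norm_eq_zero.1 h, zero_add] at h1
          have h4 : (0 : A) ≤ algebraMap ℝ A (-t) := algebraMap_nonneg _ (by linarith)
          rw [map_neg] at h4
          have h5 : algebraMap ℝ A t = 0 := le_antisymm (neg_nonneg.1 h4) h1
          have := (map_eq_zero_iff _ (algebraMap ℝ A).injective).1 h5
          linarith
      have h6 : ‖(x : A)‖ ≤ 3 * t := by
        rcases aux_interval (x : A) t h1 h2 with h | h <;> linarith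
      have := mul_le_mul_of_nonneg_left h6 (norm_nonneg f)
      linarith) (by
      rintro ⟨y, z⟩
      refine ⟨⟨j (0, ‖(y : A)‖ + ‖(z : A)‖), LinearMap.mem_range_self j _⟩, ?_⟩
      have key : ∀ (w : V) (r : ℝ), ‖(w : A)‖ ≤ r → (0 : A) ≤ algebraMap ℝ A r + w := by
        intro w r hr
        have h1 := IsSelfAdjoint.neg_algebraMap_norm_le_self (a := (w : A)) w.2
        have h2 : algebraMap ℝ A ‖(w : A)‖ ≤ algebraMap ℝ A r := algebraMap_mono A hr
        have h3 := add_le_add h2 h1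
        simpa using h3
      constructor
      · have := key y (‖(y : A)‖ + ‖(z : A)‖) (by linarith [norm_nonneg (z : A)])
        rw [← hal] at this
        simpa [j] using this
      · have := key z (‖(y : A)‖ + ‖(z : A)‖) (by linarith [norm_nonneg (y : A)])
        rw [← hal] at this
        simpa [j] using this)
  have hΦj : ∀ q, Φ (j q) = F q := fun q => (hΦ ⟨j q, LinearMap.mem_range_self j q⟩).trans (hp q)
  obtain ⟨f₁, hf₁, hf₁'⟩ := aux_extend (Φ ∘ₗ LinearMap.inl ℝ V V)
    (fun x hx => hΦs _ ⟨hx, le_rfl⟩)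
  obtain ⟨f₂, hf₂, hf₂'⟩ := aux_extend (Φ ∘ₗ LinearMap.inr ℝ V V)
    (fun x hx => hΦs _ ⟨le_rfl, hx⟩)
  have hdiff : ∀ x : V, Φ (x, 0) - Φ (0, x) = (f (x : A)).re := by
    intro x
    have h := hΦj (x, 0)
    have h2 : j (x, 0) = (x, 0) - (0, x) := by ext <;> simp [j]
    rw [h2, map_sub] at h
    rw [h]; simp [F]
  have hreal : ∀ x : V, ((f (x : A)).re : ℂ) = f x := by
    intro x
    have h := hf (x : A)
    rw [x.2.star_eq] at h
    exact Complex.conj_eq_iff_re.1 h.symm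
  refine ⟨f₁, f₂, hf₁, hf₂, ?_, ?_⟩
  · ext x
    rw [sub_apply, hf₁', hf₂']
    conv_lhs => rw [← realPart_add_I_smul_imaginaryPart x, map_add, map_smul, ← hreal (ℜ x),
      ← hreal (ℑ x), ← hdiff (ℜ x), ← hdiff (ℑ x)]
    change _ = ((Φ (ℜ x, 0) : ℂ) + (Φ (ℑ x, 0) : ℂ) * Complex.I) -
      ((Φ (0, ℜ x) : ℂ) + (Φ (0, ℑ x) : ℂ) * Complex.I)
    simp only [smul_eq_mul, Complex.ofReal_sub]
    ring
  · rw [hf₁', hf₂']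
    have h := hΦj (0, 1)
    have h2 : j (0, 1) = (e, 0) + (0, e) := by ext <;> simp [j]
    rw [h2, map_add] at h
    have h1 : ℜ (1 : A) = e := by simp [e]
    have h3 : F (0, 1) = 3 * ‖f‖ := by simp [F]
    rw [h3] at h
    rw [h1]
    simp only [Complex.add_re, Complex.ofReal_re, Complex.re_ofReal_mul, Complex.I_re, mul_zero,
      add_zero]
    exact h.le

lemma aux_lower (b : A) (hb : 0 ≤ b) (f : A →L[ℂ] ℂ) (r : ℝ) (f₁ f₂ : A →L[ℂ] ℂ)
    (h₁ : IsPosFunctional f₁) (h₂ : IsPosFunctional f₂) (hr : (r : ℂ) = f₁ b + f₂ b) :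
    r = (f₁ b).re + (f₂ b).re := by
  have := congrArg Complex.re hr
  simpa using this

lemma aux_seminorm_le (b : A) (hb : 0 ≤ b) (f f₁ f₂ : A →L[ℂ] ℂ)
    (h₁ : IsPosFunctional f₁) (h₂ : IsPosFunctional f₂) (h : f = f₁ - f₂) :
    rSeminorm b f ≤ (f₁ b).re + (f₂ b).re := by
  refine csInf_le ⟨0, ?_⟩ ⟨f₁, f₂, h₁, h₂, h, ?_⟩
  · rintro r ⟨g₁, g₂, k₁, k₂, -, hr⟩
    rw [aux_lower b hb f r g₁ g₂ k₁ k₂ hr]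
    exact add_nonneg (Complex.nonneg_iff.1 (k₁ b hb)).1 (Complex.nonneg_iff.1 (k₂ b hb)).1
  · have e₁ := (Complex.nonneg_iff.1 (h₁ b hb)).2
    have e₂ := (Complex.nonneg_iff.1 (h₂ b hb)).2
    apply Complex.ext <;> simp [← e₁, ← e₂]

/-- states detecting failure of positivity -/
lemma aux_separate (x : A) (hx : IsSelfAdjoint x) (hn : ¬ 0 ≤ x) :
    ∃ φ : A →L[ℂ] ℂ, IsPosFunctional φ ∧ (φ x).re < 0 := by
  let C : ProperCone ℝ (selfAdjoint A) :=
    { carrier := {p | (0 : A) ≤ p}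
      zero_mem' := by simp
      add_mem' := by
        intro p q hp hq
        simpa using add_nonneg hp hq
      smul_mem' := by
        intro c p hp
        exact smul_nonneg c.2 hp
      isClosed' := CStarAlgebra.isClosed_nonneg.preimage continuous_subtype_val }
  obtain ⟨g, hg, hg0⟩ := C.hyperplane_separation_point (x₀ := ⟨x, hx⟩) hn
  obtain ⟨φ, hφ, hφ'⟩ := aux_extend (g : selfAdjoint A →ₗ[ℝ] ℝ) (fun y hy => hg y hy)
  refine ⟨φ, hφ, ?_⟩
  have h1 : realPart x = ⟨x, hx⟩ := Subtype.ext hx.coe_realPart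
  rw [hφ', h1]
  simpa using hg0

/-- A positive element `a` is invertible iff for every `α > 0` the seminorm `r_{a^α}` is
equivalent to the dual norm on hermitian continuous linear functionals. -/
theorem isUnit_iff_forall_rSeminorm_rpow_equiv_norm (a : A) (ha : 0 ≤ a) :
    IsUnit a ↔ ∀ α : ℝ, 0 < α → ∃ c C : ℝ, 0 < c ∧ 0 < C ∧
      ∀ f : A →L[ℂ] ℂ, IsHermitianFunctional f →
        c * ‖f‖ ≤ rSeminorm (a ^ α) f ∧ rSeminorm (a ^ α) f ≤ C * ‖f‖ := by
  constructor
  · intro hu α hα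
    have hb : 0 ≤ a ^ α := CFC.rpow_nonneg
    have hbu : IsUnit (a ^ α) := (CFC.isUnit_rpow_iff a α hα.ne' ha).2 hu
    generalize a ^ α = b at hb hbu
    obtain ⟨δ, hδ, hδb⟩ : ∃ δ : ℝ, 0 < δ ∧ algebraMap ℝ A δ ≤ b := by
      rcases subsingleton_or_nontrivial A with hA | hA
      · exact ⟨1, one_pos, (Subsingleton.elim _ _).le⟩
      · exact (CFC.exists_pos_algebraMap_le_iff (.of_nonneg hb)).2
          ((StarOrderedRing.isStrictlyPositive_iff_spectrum_pos b (.of_nonneg hb)).1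
            (hbu.isStrictlyPositive hb))
    refine ⟨δ / 4, 3 * ‖b‖ + 1, by positivity, by positivity, fun f hf => ?_⟩
    obtain ⟨f₁, f₂, h₁, h₂, h, hle⟩ := aux_jordan f hf
    have e₁ := (Complex.nonneg_iff.1 (h₁ b hb)).2
    have e₂ := (Complex.nonneg_iff.1 (h₂ b hb)).2
    constructor
    · refine le_csInf ⟨(f₁ b).re + (f₂ b).re, f₁, f₂, h₁, h₂, h, ?_⟩ ?_
      · apply Complex.ext <;> simp [← e₁, ← e₂]
      · rintro r ⟨g₁, g₂, k₁, k₂, hk, hr⟩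
        rw [aux_lower b hb f r g₁ g₂ k₁ k₂ hr]
        have m₁ := aux_mono g₁ k₁ hδb
        have m₂ := aux_mono g₂ k₂ hδb
        rw [aux_algebraMap] at m₁ m₂
        have n₁ := aux_norm_le g₁ k₁
        have n₂ := aux_norm_le g₂ k₂
        have n₃ : ‖f‖ ≤ 4 * ((g₁ 1).re + (g₂ 1).re) := by
          rw [hk]
          linarith [norm_sub_le g₁ g₂]
        have := mul_le_mul_of_nonneg_left n₃ hδ.le
        linarith
    · refine (aux_seminorm_le b hb f f₁ f₂ h₁ h₂ h).trans ?_
      have hbn : b ≤ algebraMap ℝ A ‖b‖ := IsSelfAdjoint.le_algebraMap_norm_self (.of_nonneg hb)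
      have m₁ := aux_mono f₁ h₁ hbn
      have m₂ := aux_mono f₂ h₂ hbn
      rw [aux_algebraMap] at m₁ m₂
      have := mul_le_mul_of_nonneg_left hle (norm_nonneg b)
      linarith [norm_nonneg f]
  · intro H
    obtain ⟨c, C, hc, -, hf⟩ := H 1 one_pos
    rw [CFC.rpow_one a] at hf
    have hle : algebraMap ℝ A c ≤ a := by
      by_contra hn
      rw [← sub_nonneg] at hn
      obtain ⟨φ, hφ, hlt⟩ := aux_separate (a - algebraMap ℝ A c)
        ((IsSelfAdjoint.of_nonneg ha).sub (IsSelfAdjoint.algebraMap A (.all c))) hn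
      have h1 := (hf φ (aux_hermitian φ hφ)).1
      have h2 := aux_seminorm_le a ha φ φ 0 hφ (fun _ _ => by simp) (by simp)
      rw [map_sub, Complex.sub_re, aux_algebraMap] at hlt
      have h3 : (φ 1).re ≤ ‖φ‖ := by
        rcases subsingleton_or_nontrivial A with hA | hA
        · rw [Subsingleton.elim (1 : A) 0]; simp
        · have := (Complex.re_le_norm _).trans (φ.le_opNorm 1)
          simpa using this
      have h4 := mul_le_mul_of_nonneg_left h3 hc.le
      simp at h2
      linarith
    exact CStarAlgebra.isUnit_of_le _ hle (isStrictlyPositive_algebraMap hc)
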